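/- In the category Grpol of polarized graphs, the class S of strict monomorphisms is a stable system of monos (it contains all isomorphisms, is closed under composition, and is stable under pullback), and Grpol has an S-partial map classifier (𝕋, η) where, for a polarized graph K̂ = (K, N_K⁺, N_K⁻), 𝕋(K̂) is the disjoint union of K̂ with one extra node * having both polarities (i.e. * ∈ N⁺ and * ∈ N⁻) and with one extra edge *_{n,p} : n → p for each pair (n,p) ∈ (N_K⁺ ⊔ {*}) × (N_K⁻ ⊔ {*}), and η_{K̂} is the evident inclusion. -/

import Mathlib

open CategoryTheory CategoryTheory.Limits

universe u

/-- A polarized graph: a graph with subsets `N⁺`, `N⁻` of nodes such that every edge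
`n → p` has `n ∈ N⁺` and `p ∈ N⁻`. -/
structure PolGrph : Type (u + 1) where
  N : Type u
  E : Type u
  s : E → N
  t : E → N
  Np : Set N
  Nm : Set N
  s_mem : ∀ e, s e ∈ Np
  t_mem : ∀ e, t e ∈ Nm

/-- A morphism of polarized graphs: a graph morphism preserving both polarities. -/
structure PolGrph.Hom (X Y : PolGrph.{u}) : Type u where
  onN : X.N → Y.N
  onE : X.E → Y.E
  map_s : ∀ e, Y.s (onE e) = onN (X.s e)
  map_t : ∀ e, Y.t (onE e) = onN (X.t e)
  mapNp : ∀ n ∈ X.Np, onN n ∈ Y.Np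
  mapNm : ∀ n ∈ X.Nm, onN n ∈ Y.Nm

/-- The category `Grpol` of polarized graphs. -/
instance : Category PolGrph.{u} where
  Hom := PolGrph.Hom
  id X := ⟨id, id, fun _ => rfl, fun _ => rfl, fun _ h => h, fun _ h => h⟩
  comp f g := ⟨g.onN ∘ f.onN, g.onE ∘ f.onE,
    fun e => by simp only [Function.comp_apply, g.map_s, f.map_s],
    fun e => by simp only [Function.comp_apply, g.map_t, f.map_t],
    fun n h => g.mapNp _ (f.mapNp n h), fun n h => g.mapNm _ (f.mapNm n h)⟩

theorem PolGrph.Hom.ext' {X Y : PolGrph.{u}} {f g : X ⟶ Y}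
    (h1 : f.onN = g.onN) (h2 : f.onE = g.onE) : f = g := by
  have key : ∀ f g : PolGrph.Hom X Y, f.onN = g.onN → f.onE = g.onE → f = g := by
    intro f g h1 h2
    cases f; cases g; cases h1; cases h2; rfl
  exact key f g h1 h2

/-- A morphism of polarized graphs is strict if `f(N_X⁺) = f(N_X) ∩ N_Y⁺` and
`f(N_X⁻) = f(N_X) ∩ N_Y⁻`. -/
def PolGrph.Hom.Strict {X Y : PolGrph.{u}} (f : X ⟶ Y) : Prop :=
  f.onN '' X.Np = Set.range f.onN ∩ Y.Np ∧ f.onN '' X.Nm = Set.range f.onN ∩ Y.Nm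

/-- The stable system `S` of strict monos of `Grpol`. -/
def StrictMonos {X Y : PolGrph.{u}} (f : X ⟶ Y) : Prop :=
  Mono f ∧ PolGrph.Hom.Strict f

/-- The object part of the `S`-partial map classifier of `Grpol`: `𝕋(K̂)` is the disjoint
union of `K̂` with a node `*` of both polarities and an edge `*_{n,p} : n → p` for every
pair `(n, p) ∈ (N⁺ ⊔ {*}) × (N⁻ ⊔ {*})`. -/
def TPolObj (K : PolGrph.{u}) : PolGrph.{u} where
  N := Option K.N
  E := K.E ⊕ (Option K.Np × Option K.Nm)
  s := fun e => match e with
    | .inl e => some (K.s e)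
    | .inr p => Option.map Subtype.val p.1
  t := fun e => match e with
    | .inl e => some (K.t e)
    | .inr p => Option.map Subtype.val p.2
  Np := insert none (some '' K.Np)
  Nm := insert none (some '' K.Nm)
  s_mem := by
    rintro (e | ⟨a, b⟩)
    · exact Set.mem_insert_iff.mpr (Or.inr ⟨_, K.s_mem e, rfl⟩)
    · cases a with
      | none => exact Set.mem_insert _ _
      | some x => exact Set.mem_insert_iff.mpr (Or.inr ⟨x.1, x.2, rfl⟩)
  t_mem := by
    rintro (e | ⟨a, b⟩)
    · exact Set.mem_insert_iff.mpr (Or.inr ⟨_, K.t_mem e, rfl⟩)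
    · cases b with
      | none => exact Set.mem_insert _ _
      | some x => exact Set.mem_insert_iff.mpr (Or.inr ⟨x.1, x.2, rfl⟩)

/-- The component at `K̂` of the unit `η : Id ⟶ 𝕋`: the evident inclusion. -/
def etaPol (K : PolGrph.{u}) : K ⟶ TPolObj K where
  onN := some
  onE := Sum.inl
  map_s := fun _ => rfl
  map_t := fun _ => rfl
  mapNp := fun n h => Set.mem_insert_iff.mpr (Or.inr ⟨n, h, rfl⟩)
  mapNm := fun n h => Set.mem_insert_iff.mpr (Or.inr ⟨n, h, rfl⟩)

namespace PolGrph

variable {V W X Y Z : PolGrph.{u}}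

theorem hom_ext {f g : X ⟶ Y} (hN : ∀ n, f.onN n = g.onN n) (hE : ∀ e, f.onE e = g.onE e) :
    f = g :=
  Hom.ext' (funext hN) (funext hE)

/-- The edgeless graph on one node, which is positive iff `P` and negative iff `Q`. -/
def point (P Q : Prop) : PolGrph.{u} where
  N := PUnit
  E := PEmpty
  s := PEmpty.elim
  t := PEmpty.elim
  Np := {_n | P}
  Nm := {_n | Q}
  s_mem := fun e => e.elim
  t_mem := fun e => e.elim

/-- The morphism out of a point picking a node of the right polarities. -/
def pointHom {P Q : Prop} (n : X.N) (hP : P → n ∈ X.Np) (hQ : Q → n ∈ X.Nm) :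
    point P Q ⟶ X where
  onN := fun _ => n
  onE := PEmpty.elim
  map_s := fun e => e.elim
  map_t := fun e => e.elim
  mapNp := fun _ h => hP h
  mapNm := fun _ h => hQ h

/-- The graph with two nodes and a single edge between them. -/
def arrow : PolGrph.{u} where
  N := ULift Bool
  E := PUnit
  s := fun _ => ⟨false⟩
  t := fun _ => ⟨true⟩
  Np := {⟨false⟩}
  Nm := {⟨true⟩}
  s_mem := fun _ => rfl
  t_mem := fun _ => rfl

/-- The morphism out of the walking edge picking a given edge. -/
def arrowHom (e : X.E) : arrow ⟶ X where
  onN := fun b => bif b.down then X.t e else X.s e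
  onE := fun _ => e
  map_s := fun _ => rfl
  map_t := fun _ => rfl
  mapNp := by
    rintro _ rfl
    exact X.s_mem e
  mapNm := by
    rintro _ rfl
    exact X.t_mem e

theorem arrowHom_comp (e : X.E) (f : X ⟶ Y) : arrowHom e ≫ f = arrowHom (f.onE e) := by
  refine hom_ext ?_ fun _ => rfl
  rintro ⟨_ | _⟩
  · exact (f.map_s e).symm
  · exact (f.map_t e).symm

theorem onN_injective (f : X ⟶ Y) [Mono f] : Function.Injective f.onN := by
  intro a b h
  have key : (pointHom a False.elim False.elim : point.{u} False False ⟶ X) =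
      pointHom b False.elim False.elim :=
    (cancel_mono f).1 (hom_ext (fun _ => h) fun e => e.elim)
  exact congrArg (fun k : point.{u} False False ⟶ X => k.onN PUnit.unit) key

theorem onE_injective (f : X ⟶ Y) [Mono f] : Function.Injective f.onE := by
  intro a b h
  have key : arrowHom a = arrowHom b :=
    (cancel_mono f).1 (by rw [arrowHom_comp, arrowHom_comp, h])
  exact congrArg (fun k : arrow ⟶ X => k.onE PUnit.unit) key

theorem mono_of_injective (f : X ⟶ Y) (hN : Function.Injective f.onN)
    (hE : Function.Injective f.onE) : Mono f where
  right_cancellation _ _ w := hom_ext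
    (fun n => hN (congrArg (fun k : _ ⟶ Y => k.onN n) w))
    (fun e => hE (congrArg (fun k : _ ⟶ Y => k.onE e) w))

theorem strictMonos_iff (f : X ⟶ Y) :
    StrictMonos f ↔ Mono f ∧ (∀ n, f.onN n ∈ Y.Np → n ∈ X.Np) ∧
      ∀ n, f.onN n ∈ Y.Nm → n ∈ X.Nm := by
  refine and_congr_right fun _ => and_congr ⟨fun h n hn => ?_, fun h => ?_⟩
    ⟨fun h n hn => ?_, fun h => ?_⟩
  · exact (onN_injective f).mem_set_image.1 (h ▸ ⟨⟨n, rfl⟩, hn⟩)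
  · refine Set.Subset.antisymm ?_ ?_
    · rintro _ ⟨n, hn, rfl⟩
      exact ⟨⟨n, rfl⟩, f.mapNp n hn⟩
    · rintro _ ⟨⟨n, rfl⟩, hn⟩
      exact ⟨n, h n hn, rfl⟩
  · exact (onN_injective f).mem_set_image.1 (h ▸ ⟨⟨n, rfl⟩, hn⟩)
  · refine Set.Subset.antisymm ?_ ?_
    · rintro _ ⟨n, hn, rfl⟩
      exact ⟨⟨n, rfl⟩, f.mapNm n hn⟩
    · rintro _ ⟨⟨n, rfl⟩, hn⟩
      exact ⟨n, h n hn, rfl⟩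

theorem strictMonos_of_isIso (f : X ⟶ Y) [IsIso f] : StrictMonos f := by
  have inv_onN (n : X.N) : (inv f).onN (f.onN n) = n :=
    congrArg (fun k : X ⟶ X => k.onN n) (IsIso.hom_inv_id f)
  refine (strictMonos_iff f).2 ⟨inferInstance, fun n hn => ?_, fun n hn => ?_⟩
  · exact inv_onN n ▸ (inv f).mapNp _ hn
  · exact inv_onN n ▸ (inv f).mapNm _ hn

theorem _root_.StrictMonos.comp {f : X ⟶ Y} {g : Y ⟶ Z} (hf : StrictMonos f) (hg : StrictMonos g) :
    StrictMonos (f ≫ g) := by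
  rw [strictMonos_iff] at *
  have := hf.1
  have := hg.1
  exact ⟨mono_comp f g, fun n hn => hf.2.1 n (hg.2.1 _ hn), fun n hn => hf.2.2 n (hg.2.2 _ hn)⟩

section Pullback

variable {fst : W ⟶ X} {snd : W ⟶ Y} {f : X ⟶ Z} {g : Y ⟶ Z}

theorem exists_node_of_isPullback (h : IsPullback fst snd f g) {x : X.N} {y : Y.N}
    (hxy : f.onN x = g.onN y) :
    ∃ w, fst.onN w = x ∧ snd.onN w = y ∧ (x ∈ X.Np → y ∈ Y.Np → w ∈ W.Np) ∧
      (x ∈ X.Nm → y ∈ Y.Nm → w ∈ W.Nm) := by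
  let a : point.{u} (x ∈ X.Np ∧ y ∈ Y.Np) (x ∈ X.Nm ∧ y ∈ Y.Nm) ⟶ X :=
    pointHom x And.left And.left
  let b : point.{u} (x ∈ X.Np ∧ y ∈ Y.Np) (x ∈ X.Nm ∧ y ∈ Y.Nm) ⟶ Y :=
    pointHom y And.right And.right
  have hab : a ≫ f = b ≫ g := hom_ext (fun _ => hxy) fun e => e.elim
  let l := h.lift a b hab
  exact ⟨l.onN PUnit.unit,
    congrArg (fun k : point.{u} _ _ ⟶ X => k.onN PUnit.unit) (h.lift_fst a b hab),
    congrArg (fun k : point.{u} _ _ ⟶ Y => k.onN PUnit.unit) (h.lift_snd a b hab),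
    fun hx hy => l.mapNp PUnit.unit ⟨hx, hy⟩, fun hx hy => l.mapNm PUnit.unit ⟨hx, hy⟩⟩

theorem exists_edge_of_isPullback (h : IsPullback fst snd f g) {x : X.E} {y : Y.E}
    (hxy : f.onE x = g.onE y) : ∃ w, fst.onE w = x ∧ snd.onE w = y := by
  have hab : arrowHom x ≫ f = arrowHom y ≫ g := by rw [arrowHom_comp, arrowHom_comp, hxy]
  exact ⟨(h.lift _ _ hab).onE PUnit.unit,
    congrArg (fun k : arrow ⟶ X => k.onE PUnit.unit) (h.lift_fst _ _ hab),
    congrArg (fun k : arrow ⟶ Y => k.onE PUnit.unit) (h.lift_snd _ _ hab)⟩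

theorem _root_.StrictMonos.of_isPullback (h : IsPullback fst snd f g) (hf : StrictMonos f) :
    StrictMonos snd := by
  have := hf.1
  have hsnd : Mono snd := h.mono_snd_of_mono
  rw [strictMonos_iff] at hf ⊢
  have w_onN (n : W.N) : f.onN (fst.onN n) = g.onN (snd.onN n) :=
    congrArg (fun k : W ⟶ Z => k.onN n) h.w
  refine ⟨hsnd, fun n hn => ?_, fun n hn => ?_⟩
  · obtain ⟨w, -, hw, hp, -⟩ := exists_node_of_isPullback h (w_onN n)
    exact onN_injective snd hw ▸ hp (hf.2.1 _ (w_onN n ▸ g.mapNp _ hn)) hn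
  · obtain ⟨w, -, hw, -, hm⟩ := exists_node_of_isPullback h (w_onN n)
    exact onN_injective snd hw ▸ hm (hf.2.2 _ (w_onN n ▸ g.mapNm _ hn)) hn

end Pullback

theorem _root_.StrictMonos.exists_lift {m : X ⟶ Z} (hm : StrictMonos m) (k : V ⟶ Z)
    (hN : ∀ n, k.onN n ∈ Set.range m.onN) (hE : ∀ e, k.onE e ∈ Set.range m.onE) :
    ∃ l : V ⟶ X, l ≫ m = k := by
  have := hm.1
  rw [strictMonos_iff] at hm
  choose lN hlN using hN
  choose lE hlE using hE
  refine ⟨⟨lN, lE, fun e => onN_injective m ?_, fun e => onN_injective m ?_,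
    fun n hn => hm.2.1 _ ?_, fun n hn => hm.2.2 _ ?_⟩, hom_ext hlN hlE⟩
  · rw [← m.map_s, hlE, hlN, k.map_s]
  · rw [← m.map_t, hlE, hlN, k.map_t]
  · exact hlN n ▸ k.mapNp n hn
  · exact hlN n ▸ k.mapNm n hn

theorem isPullback_of_strictMonos {f : X ⟶ Y} {m : X ⟶ Z} {i : Y ⟶ W} {φ : Z ⟶ W} [Mono i]
    (hm : StrictMonos m) (w : f ≫ i = m ≫ φ)
    (hN : ∀ z, φ.onN z ∈ Set.range i.onN → z ∈ Set.range m.onN)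
    (hE : ∀ e, φ.onE e ∈ Set.range i.onE → e ∈ Set.range m.onE) :
    IsPullback f m i φ := by
  have := hm.1
  have exists_lift (c : PullbackCone i φ) : ∃ l : c.pt ⟶ X, l ≫ m = c.snd :=
    hm.exists_lift c.snd
      (fun n => hN _ ⟨c.fst.onN n, congrArg (fun k : c.pt ⟶ W => k.onN n) c.condition⟩)
      (fun e => hE _ ⟨c.fst.onE e, congrArg (fun k : c.pt ⟶ W => k.onE e) c.condition⟩)
  choose l hl using exists_lift
  refine ⟨⟨w⟩, ⟨PullbackCone.IsLimit.mk w l (fun c => ?_) hl (fun c k _ hk => ?_)⟩⟩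
  · rw [← cancel_mono i, Category.assoc, w, c.condition, ← Category.assoc, hl]
  · rw [← cancel_mono m, hk, hl]

instance (Y : PolGrph.{u}) : Mono (etaPol Y) :=
  mono_of_injective _ (Option.some_injective _) Sum.inl_injective

theorem TPolObj_Np_iff (n : (TPolObj Y).N) :
    n ∈ (TPolObj Y).Np ↔ ∃ a : Option Y.Np, a.map Subtype.val = n := by
  constructor
  · rintro (rfl | ⟨y, hy, rfl⟩)
    · exact ⟨none, rfl⟩
    · exact ⟨some ⟨y, hy⟩, rfl⟩
  · rintro ⟨_ | y, rfl⟩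
    · exact Set.mem_insert _ _
    · exact Or.inr ⟨y.1, y.2, rfl⟩

theorem TPolObj_Nm_iff (n : (TPolObj Y).N) :
    n ∈ (TPolObj Y).Nm ↔ ∃ a : Option Y.Nm, a.map Subtype.val = n := by
  constructor
  · rintro (rfl | ⟨y, hy, rfl⟩)
    · exact ⟨none, rfl⟩
    · exact ⟨some ⟨y, hy⟩, rfl⟩
  · rintro ⟨_ | y, rfl⟩
    · exact Set.mem_insert _ _
    · exact Or.inr ⟨y.1, y.2, rfl⟩

/-- Added edges of `TPolObj Y` are determined by their endpoints. -/
theorem TPolObj_inr_ext {p q : Option Y.Np × Option Y.Nm}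
    (hs : (TPolObj Y).s (.inr p) = (TPolObj Y).s (.inr q))
    (ht : (TPolObj Y).t (.inr p) = (TPolObj Y).t (.inr q)) : p = q :=
  Prod.ext (Option.map_injective Subtype.val_injective hs)
    (Option.map_injective Subtype.val_injective ht)

theorem exists_isPullback_etaPol {m : X ⟶ Z} (hm : StrictMonos m) (f : X ⟶ Y) :
    ∃ φ : Z ⟶ TPolObj Y, IsPullback f m (etaPol Y) φ := by
  have := hm.1
  obtain ⟨-, hp, hn⟩ := (strictMonos_iff m).1 hm
  have hφN : ∃ φN : Z.N → (TPolObj Y).N, (∀ x, φN (m.onN x) = some (f.onN x)) ∧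
      ∀ z, z ∉ Set.range m.onN → φN z = none :=
    ⟨Function.extend m.onN (fun x => some (f.onN x)) fun _ => none,
      (onN_injective m).extend_apply _ _, fun z hz => Function.extend_apply' _ _ _ hz⟩
  obtain ⟨φN, hφN, hφN'⟩ := hφN
  have hNp : ∀ z ∈ Z.Np, φN z ∈ (TPolObj Y).Np := by
    intro z hz
    by_cases h : z ∈ Set.range m.onN
    · obtain ⟨x, rfl⟩ := h
      rw [hφN]
      exact (etaPol Y).mapNp _ (f.mapNp x (hp x hz))
    · rw [hφN' z h]
      exact Set.mem_insert _ _
  have hNm : ∀ z ∈ Z.Nm, φN z ∈ (TPolObj Y).Nm := by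
    intro z hz
    by_cases h : z ∈ Set.range m.onN
    · obtain ⟨x, rfl⟩ := h
      rw [hφN]
      exact (etaPol Y).mapNm _ (f.mapNm x (hn x hz))
    · rw [hφN' z h]
      exact Set.mem_insert _ _
  choose a ha using fun e => (TPolObj_Np_iff _).1 (hNp _ (Z.s_mem e))
  choose b hb using fun e => (TPolObj_Nm_iff _).1 (hNm _ (Z.t_mem e))
  have hφE : ∃ φE : Z.E → (TPolObj Y).E, (∀ x, φE (m.onE x) = .inl (f.onE x)) ∧
      ∀ e, e ∉ Set.range m.onE → φE e = .inr (a e, b e) :=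
    ⟨Function.extend m.onE (fun x => .inl (f.onE x)) fun e => .inr (a e, b e),
      (onE_injective m).extend_apply _ _, fun e he => Function.extend_apply' _ _ _ he⟩
  obtain ⟨φE, hφE, hφE'⟩ := hφE
  let φ : Z ⟶ TPolObj Y :=
    { onN := φN
      onE := φE
      map_s := fun e => by
        by_cases h : e ∈ Set.range m.onE
        · obtain ⟨x, rfl⟩ := h
          rw [hφE, m.map_s, hφN, ← f.map_s]
          rfl
        · rw [hφE' e h]
          exact ha e
      map_t := fun e => by
        by_cases h : e ∈ Set.range m.onE
        · obtain ⟨x, rfl⟩ := h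
          rw [hφE, m.map_t, hφN, ← f.map_t]
          rfl
        · rw [hφE' e h]
          exact hb e
      mapNp := hNp
      mapNm := hNm }
  refine ⟨φ, isPullback_of_strictMonos hm
    (hom_ext (fun x => (hφN x).symm) fun x => (hφE x).symm) ?_ ?_⟩
  · rintro z ⟨y, hy⟩
    by_contra h
    exact Option.some_ne_none y (hy.trans (hφN' z h))
  · rintro e ⟨y, hy⟩
    by_contra h
    exact Sum.inl_ne_inr (hy.trans (hφE' e h))

theorem isPullback_etaPol_unique {m : X ⟶ Z} {f : X ⟶ Y} {φ ψ : Z ⟶ TPolObj Y}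
    (hφ : IsPullback f m (etaPol Y) φ) (hψ : IsPullback f m (etaPol Y) ψ) : φ = ψ := by
  have w : m ≫ φ = m ≫ ψ := hφ.w.symm.trans hψ.w
  have node_none {χ : Z ⟶ TPolObj Y} (hχ : IsPullback f m (etaPol Y) χ) {z : Z.N}
      (hz : z ∉ Set.range m.onN) : χ.onN z = none := by
    refine Option.eq_none_iff_forall_ne_some.2 fun y hy => hz ?_
    obtain ⟨x, -, hx, -⟩ := exists_node_of_isPullback hχ (x := y) hy.symm
    exact ⟨x, hx⟩
  have edge_inr {χ : Z ⟶ TPolObj Y} (hχ : IsPullback f m (etaPol Y) χ) {e : Z.E}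
      (he : e ∉ Set.range m.onE) : ∃ p, χ.onE e = .inr p := by
    rcases hy : χ.onE e with y | p
    · obtain ⟨x, -, hx⟩ := exists_edge_of_isPullback hχ (x := y) hy.symm
      exact absurd ⟨x, hx⟩ he
    · exact ⟨p, rfl⟩
  have hN (z : Z.N) : φ.onN z = ψ.onN z := by
    by_cases h : z ∈ Set.range m.onN
    · obtain ⟨x, rfl⟩ := h
      exact congrArg (fun k : X ⟶ TPolObj Y => k.onN x) w
    · rw [node_none hφ h, node_none hψ h]
  refine hom_ext hN fun e => ?_
  by_cases h : e ∈ Set.range m.onE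
  · obtain ⟨x, rfl⟩ := h
    exact congrArg (fun k : X ⟶ TPolObj Y => k.onE x) w
  · obtain ⟨p, hp⟩ := edge_inr hφ h
    obtain ⟨q, hq⟩ := edge_inr hψ h
    have hs := hN (Z.s e)
    have ht := hN (Z.t e)
    rw [← φ.map_s, ← ψ.map_s, hp, hq] at hs
    rw [← φ.map_t, ← ψ.map_t, hp, hq] at ht
    rw [hp, hq, TPolObj_inr_ext hs ht]

end PolGrph

/-- in the category `Grpol` of polarized graphs, the class `S` of strict
monomorphisms is a stable system of monos (it contains all isomorphisms, is closed under
composition and is stable under pullback), and `Grpol` has an `S`-partial map classifier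
`(𝕋, η)` given by `TPolObj` and `etaPol`. -/
theorem polGrph_strictMonos_partialMapClassifier :
    (∀ {X Y : PolGrph.{u}} (f : X ⟶ Y), IsIso f → StrictMonos f) ∧
    (∀ {X Y Z : PolGrph.{u}} (f : X ⟶ Y) (g : Y ⟶ Z),
      StrictMonos f → StrictMonos g → StrictMonos (f ≫ g)) ∧
    (∀ {W X Y Z : PolGrph.{u}} (m : X ⟶ Z) (f : Y ⟶ Z) (f' : W ⟶ X) (m' : W ⟶ Y),
      IsPullback f' m' m f → StrictMonos m → StrictMonos m') ∧
    ∀ {X Y Z : PolGrph.{u}} (m : X ⟶ Z), StrictMonos m → ∀ f : X ⟶ Y,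
      ∃! φ : Z ⟶ TPolObj Y, IsPullback f m (etaPol Y) φ := by
  refine ⟨fun f _ => PolGrph.strictMonos_of_isIso f, fun _ _ hf hg => hf.comp hg,
    fun _ _ _ _ h hm => hm.of_isPullback h, fun m hm f => ?_⟩
  obtain ⟨φ, hφ⟩ := PolGrph.exists_isPullback_etaPol hm f
  exact ⟨φ, hφ, fun _ hψ => PolGrph.isPullback_etaPol_unique hψ hφ⟩
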